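/- Full Modal Team Logic FMTL enjoys uniform interpolation: for every FMTL formula φ and every L' ⊆ L(φ), there is an FMTL formula θ with L(θ) ⊆ L' such that φ ⊨ θ, and θ ⊨ ψ whenever φ ⊨ ψ and L(φ)∩L(ψ) ⊆ L'. -/

import Mathlib

/-- A Kripke model `M = (W, R, V)` over a set `V` of propositional letters. -/
structure KModel (V : Type) : Type 1 where
  W : Type
  R : W → W → Prop
  val : W → V → Prop

variable {V : Type}

/-- `B` is a `P`-bisimulation between the Kripke models `M` and `N`:
related points agree on all propositions of `P`, and `B` satisfies the
forth and back conditions. -/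
def IsBisim (P : Set V) (M N : KModel V) (B : M.W → N.W → Prop) : Prop :=
  (∀ w v, B w v → ∀ p ∈ P, (M.val w p ↔ N.val v p)) ∧
  (∀ w v, B w v → ∀ w', M.R w w' → ∃ v', N.R v v' ∧ B w' v') ∧
  (∀ w v, B w v → ∀ v', N.R v v' → ∃ w', M.R w w' ∧ B w' v')

/-- `(M,w) ⇌_P (N,v)`: some `P`-bisimulation relates `w` and `v`. -/
def Bisimilar (P : Set V) (M : KModel V) (w : M.W) (N : KModel V) (v : N.W) : Prop :=
  ∃ B, IsBisim P M N B ∧ B w v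

/-- Team `P`-bisimulation `(M,X) ⇌_P (N,Y)`: every point of `X` is
`P`-bisimilar to some point of `Y` and conversely. -/
def TeamBisim (P : Set V) (M : KModel V) (X : Set M.W) (N : KModel V) (Y : Set N.W) : Prop :=
  (∀ x ∈ X, ∃ y ∈ Y, Bisimilar P M x N y) ∧
  (∀ y ∈ Y, ∃ x ∈ X, Bisimilar P M x N y)

/-- Formulas of Full Modal Team Logic: literals, `⊥`, `NE`, `∧`, `⊗`, `∨`,
`◇`, `□`. -/
inductive MForm (V : Type) : Type where
  | var : V → MForm V
  | nvar : V → MForm V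
  | bot : MForm V
  | ne : MForm V
  | and : MForm V → MForm V → MForm V
  | tens : MForm V → MForm V → MForm V
  | or : MForm V → MForm V → MForm V
  | dia : MForm V → MForm V
  | box : MForm V → MForm V

/-- `R(X) = {t : ∃ s ∈ X, sRt}`. -/
def KModel.img (M : KModel V) (X : Set M.W) : Set M.W := {t | ∃ s ∈ X, M.R s t}

/-- `X R Y`: every point of `X` has an `R`-successor in `Y` and every point
of `Y` has an `R`-predecessor in `X`. -/
def teamR (M : KModel V) (X Y : Set M.W) : Prop :=
  (∀ x ∈ X, ∃ y ∈ Y, M.R x y) ∧ (∀ y ∈ Y, ∃ x ∈ X, M.R x y)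

/-- Modal team semantics of Full Modal Team Logic. -/
def MSat (M : KModel V) : Set M.W → MForm V → Prop
  | X, .var p => ∀ s ∈ X, M.val s p
  | X, .nvar p => ∀ s ∈ X, ¬ M.val s p
  | X, .bot => X = ∅
  | X, .ne => X ≠ ∅
  | X, .and φ ψ => MSat M X φ ∧ MSat M X ψ
  | X, .tens φ ψ => ∃ X₁ X₂, X = X₁ ∪ X₂ ∧ MSat M X₁ φ ∧ MSat M X₂ ψ
  | X, .or φ ψ => MSat M X φ ∨ MSat M X ψ
  | X, .dia φ => ∃ Y, teamR M X Y ∧ MSat M Y φ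
  | X, .box φ => MSat M (M.img X) φ

/-- The set `L(φ)` of propositional letters occurring in `φ` (these are
exactly the free variables of an `FMTL` formula). -/
def mletters : MForm V → Set V
  | .var p => {p}
  | .nvar p => {p}
  | .bot => ∅
  | .ne => ∅
  | .and φ ψ => mletters φ ∪ mletters ψ
  | .tens φ ψ => mletters φ ∪ mletters ψ
  | .or φ ψ => mletters φ ∪ mletters ψ
  | .dia φ => mletters φ
  | .box φ => mletters φ

/-- The `n`-step bisimulation types over the letters `P`. -/
def BisimType (P : Set V) : ℕ → Type
  | 0 => Set P
  | n + 1 => Set P × Set (BisimType P n)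

instance BisimType.finite (P : Set V) [Finite P] : ∀ n, Finite (BisimType P n)
  | 0 => inferInstanceAs (Finite (Set P))
  | n + 1 =>
    have := BisimType.finite P n
    inferInstanceAs (Finite (Set P × Set (BisimType P n)))

/-- The `n`-step bisimulation type of a world. -/
def bisimType (P : Set V) (M : KModel V) : (n : ℕ) → M.W → BisimType P n
  | 0, w => {p : P | M.val w p}
  | n + 1, w => ({p : P | M.val w p}, bisimType P M n '' {w' | M.R w w'})

theorem letters_eq_iff {P : Set V} {M N : KModel V} {w : M.W} {v : N.W} :
    {p : P | M.val w p} = {p : P | N.val v p} ↔ ∀ p ∈ P, (M.val w p ↔ N.val v p) := by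
  simp [Set.ext_iff]

theorem bisimType_zero_eq_iff {P : Set V} {M N : KModel V} {w : M.W} {v : N.W} :
    bisimType P M 0 w = bisimType P N 0 v ↔ ∀ p ∈ P, (M.val w p ↔ N.val v p) :=
  letters_eq_iff

theorem image_subset_image_iff {α β γ : Type*} {f : α → γ} {g : β → γ} {A : Set α} {B : Set β} :
    f '' A ⊆ g '' B ↔ ∀ a ∈ A, ∃ b ∈ B, f a = g b := by
  rw [Set.image_subset_iff]
  exact forall₂_congr fun a _ => exists_congr fun b => and_congr_right fun _ => eq_comm

theorem image_eq_image_iff {α β γ : Type*} {f : α → γ} {g : β → γ} {A : Set α} {B : Set β} :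
    f '' A = g '' B ↔ (∀ a ∈ A, ∃ b ∈ B, f a = g b) ∧ (∀ b ∈ B, ∃ a ∈ A, f a = g b) := by
  rw [Set.Subset.antisymm_iff, image_subset_image_iff, image_subset_image_iff]
  simp only [eq_comm]

theorem bisimType_succ_eq_iff {P : Set V} {M N : KModel V} {n : ℕ} {w : M.W} {v : N.W} :
    bisimType P M (n + 1) w = bisimType P N (n + 1) v ↔
      (∀ p ∈ P, (M.val w p ↔ N.val v p)) ∧
      (∀ w', M.R w w' → ∃ v', N.R v v' ∧ bisimType P M n w' = bisimType P N n v') ∧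
      (∀ v', N.R v v' → ∃ w', M.R w w' ∧ bisimType P M n w' = bisimType P N n v') := by
  rw [← letters_eq_iff]
  exact Prod.mk_inj.trans (and_congr_right fun _ => image_eq_image_iff)

theorem val_iff_of_bisimType_eq {P : Set V} {M N : KModel V} {n : ℕ} {w : M.W} {v : N.W}
    (h : bisimType P M n w = bisimType P N n v) {p : V} (hp : p ∈ P) :
    M.val w p ↔ N.val v p := by
  cases n with
  | zero => exact bisimType_zero_eq_iff.1 h p hp
  | succ n => exact (bisimType_succ_eq_iff.1 h).1 p hp

/-- The modal depth of a formula. -/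
def modalDepth : MForm V → ℕ
  | .var _ => 0
  | .nvar _ => 0
  | .bot => 0
  | .ne => 0
  | .and φ ψ => max (modalDepth φ) (modalDepth ψ)
  | .tens φ ψ => max (modalDepth φ) (modalDepth ψ)
  | .or φ ψ => max (modalDepth φ) (modalDepth ψ)
  | .dia φ => modalDepth φ + 1
  | .box φ => modalDepth φ + 1

theorem image_img_eq_of_image_eq {P : Set V} {M N : KModel V} {n : ℕ} {X : Set M.W} {Y : Set N.W}
    (h : bisimType P M (n + 1) '' X = bisimType P N (n + 1) '' Y) :
    bisimType P M n '' M.img X = bisimType P N n '' N.img Y := by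
  rw [image_eq_image_iff] at h ⊢
  constructor
  · rintro w' ⟨w, hw, hR⟩
    obtain ⟨v, hv, he⟩ := h.1 w hw
    obtain ⟨v', hR', he'⟩ := (bisimType_succ_eq_iff.1 he).2.1 w' hR
    exact ⟨v', ⟨v, hv, hR'⟩, he'⟩
  · rintro v' ⟨v, hv, hR⟩
    obtain ⟨w, hw, he⟩ := h.2 v hv
    obtain ⟨w', hR', he'⟩ := (bisimType_succ_eq_iff.1 he).2.2 v' hR
    exact ⟨w', ⟨w, hw, hR'⟩, he'⟩

theorem exists_teamR_of_image_eq {P : Set V} {M N : KModel V} {n : ℕ} {X X' : Set M.W}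
    {Y : Set N.W} (h : bisimType P M (n + 1) '' X = bisimType P N (n + 1) '' Y)
    (hX : teamR M X X') :
    ∃ Y', teamR N Y Y' ∧ bisimType P M n '' X' = bisimType P N n '' Y' := by
  rw [image_eq_image_iff] at h
  refine ⟨{v' | (∃ v ∈ Y, N.R v v') ∧ ∃ w' ∈ X', bisimType P M n w' = bisimType P N n v'},
    ⟨fun v hv => ?_, fun v' hv' => hv'.1⟩,
    image_eq_image_iff.2 ⟨fun w' hw' => ?_, fun v' hv' => hv'.2⟩⟩
  · obtain ⟨w, hw, he⟩ := h.2 v hv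
    obtain ⟨w', hw', hR⟩ := hX.1 w hw
    obtain ⟨v', hR', he'⟩ := (bisimType_succ_eq_iff.1 he).2.1 w' hR
    exact ⟨v', ⟨⟨v, hv, hR'⟩, w', hw', he'⟩, hR'⟩
  · obtain ⟨w, hw, hR⟩ := hX.2 w' hw'
    obtain ⟨v, hv, he⟩ := h.1 w hw
    obtain ⟨v', hR', he'⟩ := (bisimType_succ_eq_iff.1 he).2.1 w' hR
    exact ⟨v', ⟨⟨v, hv, hR'⟩, w', hw', he'⟩, he'⟩

theorem exists_union_of_image_eq {α β γ : Type*} {f : α → γ} {g : β → γ} {A₁ A₂ : Set α}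
    {B : Set β} (h : f '' (A₁ ∪ A₂) = g '' B) :
    ∃ B₁ B₂, B = B₁ ∪ B₂ ∧ f '' A₁ = g '' B₁ ∧ f '' A₂ = g '' B₂ := by
  rw [Set.image_union] at h
  have key : ∀ A ⊆ g '' B, A = g '' (B ∩ g ⁻¹' A) := fun A hA => by
    rw [Set.image_inter_preimage, Set.inter_eq_right.2 hA]
  refine ⟨_, _, ?_, key _ (h ▸ Set.subset_union_left), key _ (h ▸ Set.subset_union_right)⟩
  rw [← Set.inter_union_distrib_left, ← Set.preimage_union, h,
    Set.inter_eq_left.2 (Set.subset_preimage_image g B)]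

/-- Formulas of modal depth at most `n` over `P` are preserved between teams that realise the
same `n`-step bisimulation types over `P`. -/
theorem MSat.of_image_eq {P : Set V} {M N : KModel V} {φ : MForm V} (hφ : mletters φ ⊆ P) {n : ℕ}
    (hn : modalDepth φ ≤ n) {X : Set M.W} {Y : Set N.W}
    (h : bisimType P M n '' X = bisimType P N n '' Y) (hX : MSat M X φ) : MSat N Y φ := by
  induction φ generalizing n X Y with
  | var p =>
    intro v hv
    obtain ⟨w, hw, he⟩ := (image_eq_image_iff.1 h).2 v hv
    exact (val_iff_of_bisimType_eq he (hφ rfl)).1 (hX w hw)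
  | nvar p =>
    intro v hv
    obtain ⟨w, hw, he⟩ := (image_eq_image_iff.1 h).2 v hv
    exact mt (val_iff_of_bisimType_eq he (hφ rfl)).2 (hX w hw)
  | bot =>
    obtain rfl : X = ∅ := hX
    exact Set.image_eq_empty.1 (h.symm.trans (Set.image_empty _))
  | ne =>
    rintro rfl
    exact hX (Set.image_eq_empty.1 (h.trans (Set.image_empty _)))
  | and φ ψ ihφ ihψ =>
    rw [mletters, Set.union_subset_iff] at hφ
    rw [modalDepth, max_le_iff] at hn
    exact ⟨ihφ hφ.1 hn.1 h hX.1, ihψ hφ.2 hn.2 h hX.2⟩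
  | tens φ ψ ihφ ihψ =>
    rw [mletters, Set.union_subset_iff] at hφ
    rw [modalDepth, max_le_iff] at hn
    obtain ⟨X₁, X₂, rfl, h₁, h₂⟩ := hX
    obtain ⟨Y₁, Y₂, rfl, e₁, e₂⟩ := exists_union_of_image_eq h
    exact ⟨Y₁, Y₂, rfl, ihφ hφ.1 hn.1 e₁ h₁, ihψ hφ.2 hn.2 e₂ h₂⟩
  | or φ ψ ihφ ihψ =>
    rw [mletters, Set.union_subset_iff] at hφ
    rw [modalDepth, max_le_iff] at hn
    exact hX.imp (ihφ hφ.1 hn.1 h) (ihψ hφ.2 hn.2 h)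
  | dia φ ih =>
    obtain ⟨n, rfl⟩ := Nat.exists_eq_add_of_le' (le_of_add_le_right hn)
    obtain ⟨X', hR, hX'⟩ := hX
    obtain ⟨Y', hR', he⟩ := exists_teamR_of_image_eq h hR
    exact ⟨Y', hR', ih hφ (Nat.le_of_succ_le_succ hn) he hX'⟩
  | box φ ih =>
    obtain ⟨n, rfl⟩ := Nat.exists_eq_add_of_le' (le_of_add_le_right hn)
    exact ih hφ (Nat.le_of_succ_le_succ hn) (image_img_eq_of_image_eq h) hX

theorem finite_mletters (φ : MForm V) : (mletters φ).Finite := by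
  induction φ with
  | var p => exact Set.finite_singleton p
  | nvar p => exact Set.finite_singleton p
  | bot => exact Set.finite_empty
  | ne => exact Set.finite_empty
  | and φ ψ ihφ ihψ => exact ihφ.union ihψ
  | tens φ ψ ihφ ihψ => exact ihφ.union ihψ
  | or φ ψ ihφ ihψ => exact ihφ.union ihψ
  | dia φ ih => exact ih
  | box φ ih => exact ih

/-- A team property is definable over `P` if it is the truth set of a formula with letters
in `P`. -/
def TeamDefinable (P : Set V) (C : ∀ M : KModel V, Set M.W → Prop) : Prop :=
  ∃ θ : MForm V, mletters θ ⊆ P ∧ ∀ (M : KModel V) (X : Set M.W), MSat M X θ ↔ C M X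

namespace TeamDefinable

variable {P : Set V} {C D : ∀ M : KModel V, Set M.W → Prop}

theorem congr (hC : TeamDefinable P C) (h : ∀ M X, C M X ↔ D M X) : TeamDefinable P D :=
  let ⟨θ, hθ, hs⟩ := hC
  ⟨θ, hθ, fun M X => (hs M X).trans (h M X)⟩

theorem and (hC : TeamDefinable P C) (hD : TeamDefinable P D) :
    TeamDefinable P fun M X => C M X ∧ D M X :=
  let ⟨θ, hθ, hs⟩ := hC
  let ⟨η, hη, ht⟩ := hD
  ⟨.and θ η, Set.union_subset hθ hη, fun M X => and_congr (hs M X) (ht M X)⟩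

theorem or (hC : TeamDefinable P C) (hD : TeamDefinable P D) :
    TeamDefinable P fun M X => C M X ∨ D M X :=
  let ⟨θ, hθ, hs⟩ := hC
  let ⟨η, hη, ht⟩ := hD
  ⟨.or θ η, Set.union_subset hθ hη, fun M X => or_congr (hs M X) (ht M X)⟩

theorem tens (hC : TeamDefinable P C) (hD : TeamDefinable P D) :
    TeamDefinable P fun M X => ∃ X₁ X₂, X = X₁ ∪ X₂ ∧ C M X₁ ∧ D M X₂ := by
  obtain ⟨θ, hθ, hs⟩ := hC
  obtain ⟨η, hη, ht⟩ := hD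
  exact ⟨.tens θ η, Set.union_subset hθ hη, fun M X => by simp only [MSat, hs, ht]⟩

theorem dia (hC : TeamDefinable P C) :
    TeamDefinable P fun M X => ∃ Y, teamR M X Y ∧ C M Y := by
  obtain ⟨θ, hθ, hs⟩ := hC
  exact ⟨.dia θ, hθ, fun M X => by simp only [MSat, hs]⟩

theorem box (hC : TeamDefinable P C) : TeamDefinable P fun M X => C M (M.img X) :=
  let ⟨θ, hθ, hs⟩ := hC
  ⟨.box θ, hθ, fun M X => hs M (M.img X)⟩

theorem empty : TeamDefinable P fun _ X => X = ∅ :=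
  ⟨.bot, Set.empty_subset P, fun _ _ => Iff.rfl⟩

theorem ne_empty : TeamDefinable P fun _ X => X ≠ ∅ :=
  ⟨.ne, Set.empty_subset P, fun _ _ => Iff.rfl⟩

theorem top : TeamDefinable P fun _ _ => True :=
  (empty.or ne_empty).congr fun _ X => by simp [Classical.em]

theorem absurd : TeamDefinable P fun _ _ => False :=
  (empty.and ne_empty).congr fun _ X => by simp

theorem forall_mem {ι : Type*} [Finite ι] (S : Set ι) {C : ι → ∀ M : KModel V, Set M.W → Prop}
    (hC : ∀ i, TeamDefinable P (C i)) : TeamDefinable P fun M X => ∀ i ∈ S, C i M X := by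
  induction S, S.toFinite using Set.Finite.induction_on with
  | empty => exact top.congr fun M X => by simp
  | @insert i _ _ _ ih => exact ((hC i).and ih).congr fun M X => by simp

theorem exists_mem {ι : Type*} [Finite ι] (S : Set ι) {C : ι → ∀ M : KModel V, Set M.W → Prop}
    (hC : ∀ i, TeamDefinable P (C i)) : TeamDefinable P fun M X => ∃ i ∈ S, C i M X := by
  induction S, S.toFinite using Set.Finite.induction_on with
  | empty => exact absurd.congr fun M X => by simp
  | @insert i _ _ _ ih => exact ((hC i).or ih).congr fun M X => by simp

theorem flat_or {c d : ∀ M : KModel V, M.W → Prop}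
    (hc : TeamDefinable P fun M X => ∀ x ∈ X, c M x)
    (hd : TeamDefinable P fun M X => ∀ x ∈ X, d M x) :
    TeamDefinable P fun M X => ∀ x ∈ X, c M x ∨ d M x := by
  refine (hc.tens hd).congr fun M X => ⟨?_, fun h => ?_⟩
  · rintro ⟨X₁, X₂, rfl, h₁, h₂⟩ x (hx | hx)
    exacts [.inl (h₁ x hx), .inr (h₂ x hx)]
  · refine ⟨{x ∈ X | c M x}, {x ∈ X | d M x}, ?_, fun x hx => hx.2, fun x hx => hx.2⟩
    rw [← Set.sep_or, Set.sep_eq_self_iff_mem_true.2 h]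

theorem flat_exists_mem {ι : Type*} [Finite ι] (S : Set ι) {c : ι → ∀ M : KModel V, M.W → Prop}
    (hc : ∀ i, TeamDefinable P fun M X => ∀ x ∈ X, c i M x) :
    TeamDefinable P fun M X => ∀ x ∈ X, ∃ i ∈ S, c i M x := by
  induction S, S.toFinite using Set.Finite.induction_on with
  | empty => exact empty.congr fun M X => by simp [Set.eq_empty_iff_forall_notMem]
  | @insert i _ _ _ ih => exact ((hc i).flat_or ih).congr fun M X => by simp

theorem flat_dia {c : ∀ M : KModel V, M.W → Prop}
    (hc : TeamDefinable P fun M X => ∀ x ∈ X, c M x) :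
    TeamDefinable P fun M X => ∀ x ∈ X, ∃ y, M.R x y ∧ c M y := by
  refine hc.dia.congr fun M X => ⟨?_, fun h => ?_⟩
  · rintro ⟨Y, hR, hY⟩ x hx
    obtain ⟨y, hy, hxy⟩ := hR.1 x hx
    exact ⟨y, hxy, hY y hy⟩
  · refine ⟨{y | (∃ x ∈ X, M.R x y) ∧ c M y}, ⟨fun x hx => ?_, fun y hy => hy.1⟩,
      fun y hy => hy.2⟩
    obtain ⟨y, hxy, hy⟩ := h x hx
    exact ⟨y, ⟨⟨x, hx, hxy⟩, hy⟩, hxy⟩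

theorem flat_letters_eq [Finite P] (A : Set P) :
    TeamDefinable P fun M X => ∀ x ∈ X, {p : P | M.val x p} = A := by
  have h : ∀ p : P, TeamDefinable P fun M X => ∀ x ∈ X, (M.val x p ↔ p ∈ A) := fun p => by
    by_cases hp : p ∈ A
    · exact ⟨.var p, by simp [mletters], fun M X => by simp [MSat, hp]⟩
    · exact ⟨.nvar p, by simp [mletters], fun M X => by simp [MSat, hp]⟩
  refine (forall_mem Set.univ h).congr fun M X => ?_
  simp only [Set.ext_iff, Set.mem_ofPred_eq, Set.mem_univ, true_implies]
  exact ⟨fun h x hx p => h p x hx, fun h p x hx => h x hx p⟩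

theorem flat_bisimType_eq [Finite P] {n : ℕ} (t : BisimType P n) :
    TeamDefinable P fun M X => ∀ x ∈ X, bisimType P M n x = t := by
  induction n with
  | zero => exact flat_letters_eq t
  | succ n ih =>
    refine (((flat_letters_eq t.1).and
      (forall_mem t.2 fun s => (ih s).flat_dia)).and (flat_exists_mem t.2 ih).box).congr
      fun M X => ?_
    have key : ∀ x, bisimType P M (n + 1) x = t ↔ {p : P | M.val x p} = t.1 ∧
        bisimType P M n '' {w' | M.R x w'} = t.2 := fun x => Prod.ext_iff
    simp only [key, Set.Subset.antisymm_iff, KModel.img, Set.mem_ofPred_eq]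
    constructor
    · rintro ⟨⟨h₁, h₂⟩, h₃⟩ x hx
      refine ⟨h₁ x hx, ?_, fun s hs => h₂ s hs x hx⟩
      rintro _ ⟨y, hy, rfl⟩
      obtain ⟨s, hs, he⟩ := h₃ y ⟨x, hx, hy⟩
      exact he ▸ hs
    · intro h
      refine ⟨⟨fun x hx => (h x hx).1, fun s hs x hx => (h x hx).2.2 hs⟩, ?_⟩
      rintro y ⟨x, hx, hy⟩
      exact ⟨_, (h x hx).2.1 ⟨y, hy, rfl⟩, rfl⟩

theorem image_bisimType_eq [Finite P] {n : ℕ} (T : Set (BisimType P n)) :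
    TeamDefinable P fun M X => bisimType P M n '' X = T := by
  refine ((flat_exists_mem T flat_bisimType_eq).and (forall_mem T fun t =>
    top.tens (ne_empty.and (flat_bisimType_eq t)))).congr fun M X => ?_
  rw [Set.Subset.antisymm_iff, Set.image_subset_iff]
  refine and_congr (forall₂_congr fun x _ => by simp) (forall₂_congr fun t _ => ⟨?_, ?_⟩)
  · rintro ⟨X₁, X₂, rfl, -, hne, h⟩
    obtain ⟨x, hx⟩ := Set.nonempty_iff_ne_empty.2 hne
    exact ⟨x, .inr hx, h x hx⟩
  · rintro ⟨x, hx, rfl⟩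
    exact ⟨X, {x}, by simp [hx], trivial, Set.singleton_ne_empty x, by simp⟩

end TeamDefinable

/-- Worlds of the amalgam: a world of `M`, together with either a number of remaining steps and
a world of `N` it is matched with, or nothing once the steps are used up. -/
def amalgam (P Q : Set V) (M N : KModel V) : KModel V where
  W := M.W × Option (ℕ × N.W)
  R
    | (v, some (n + 1, w)), (v', some (m, w')) =>
      M.R v v' ∧ N.R w w' ∧ m = n ∧ bisimType P M n v' = bisimType P N n w'
    | (_, some (_ + 1, _)), (_, none) => False
    | (v, some (0, _)), (v', none) => M.R v v'
    | (v, none), (v', none) => M.R v v'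
    | _, _ => False
  val
    | (v, some (_, w)), p => (p ∈ Q ∧ N.val w p) ∨ (p ∉ Q ∧ M.val v p)
    | (v, none), p => M.val v p

theorem bisimType_amalgam_none {P Q S : Set V} {M N : KModel V} (m : ℕ) (v : M.W) :
    bisimType S (amalgam P Q M N) m (v, none) = bisimType S M m v := by
  induction m generalizing v with
  | zero => exact bisimType_zero_eq_iff.2 fun p _ => Iff.rfl
  | succ m ih =>
    refine bisimType_succ_eq_iff.2 ⟨fun p _ => Iff.rfl, ?_, fun v' h => ⟨(v', none), h, ih v'⟩⟩
    rintro ⟨v', _ | ⟨i, w'⟩⟩ h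
    exacts [⟨v', h, ih v'⟩, h.elim]

theorem val_amalgam_iff {P Q S : Set V} {M N : KModel V} (hP : Q ∩ S ⊆ P) {n : ℕ} {v : M.W}
    {w : N.W} (h : bisimType P M n v = bisimType P N n w) :
    ∀ p ∈ S, ((amalgam P Q M N).val (v, some (n, w)) p ↔ M.val v p) := fun p hp => by
  by_cases hq : p ∈ Q
  · simp [amalgam, hq, val_iff_of_bisimType_eq h (hP ⟨hq, hp⟩)]
  · simp [amalgam, hq]

theorem bisimType_amalgam_left {P Q S : Set V} {M N : KModel V} (hP : Q ∩ S ⊆ P) (m : ℕ) {n : ℕ}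
    {v : M.W} {w : N.W} (h : bisimType P M n v = bisimType P N n w) :
    bisimType S (amalgam P Q M N) m (v, some (n, w)) = bisimType S M m v := by
  induction m generalizing n v w with
  | zero => exact bisimType_zero_eq_iff.2 (val_amalgam_iff hP h)
  | succ m ih =>
    refine bisimType_succ_eq_iff.2 ⟨val_amalgam_iff hP h, ?_, fun v' hv' => ?_⟩
    · rintro ⟨v', _ | ⟨i, w'⟩⟩ hR
      · cases n with
        | zero => exact ⟨v', hR, bisimType_amalgam_none m v'⟩
        | succ n => exact hR.elim
      · cases n with
        | zero => exact hR.elim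
        | succ n =>
          obtain ⟨hv, -, rfl, he⟩ := hR
          exact ⟨v', hv, ih he⟩
    · cases n with
      | zero => exact ⟨(v', none), hv', bisimType_amalgam_none m v'⟩
      | succ n =>
        obtain ⟨w', hw', he⟩ := (bisimType_succ_eq_iff.1 h).2.1 v' hv'
        exact ⟨(v', some (n, w')), ⟨hv', hw', rfl, he⟩, ih he⟩

theorem bisimType_amalgam_right {P Q : Set V} {M N : KModel V} {n : ℕ} {v : M.W} {w : N.W}
    (h : bisimType P M n v = bisimType P N n w) :
    bisimType Q (amalgam P Q M N) n (v, some (n, w)) = bisimType Q N n w := by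
  induction n generalizing v w with
  | zero => exact bisimType_zero_eq_iff.2 fun p hp => by simp [amalgam, hp]
  | succ n ih =>
    refine bisimType_succ_eq_iff.2 ⟨fun p hp => by simp [amalgam, hp], ?_, fun w' hw' => ?_⟩
    · rintro ⟨v', _ | ⟨i, w'⟩⟩ hR
      · exact hR.elim
      · obtain ⟨-, hw, rfl, he⟩ := hR
        exact ⟨w', hw, ih he⟩
    · obtain ⟨v', hv', he⟩ := (bisimType_succ_eq_iff.1 h).2.2 w' hw'
      exact ⟨(v', some (n, w')), ⟨hv', hw', rfl, he⟩, ih he⟩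

/-- Teams realising the same `n`-step types over `P` can be amalgamated into one team that looks
like the first over `S` and, up to `n` steps, like the second over `Q`, when `Q ∩ S ⊆ P`. -/
theorem exists_team_amalgam {P Q S : Set V} {M N : KModel V} {n : ℕ} {X : Set M.W} {Y : Set N.W}
    (hP : Q ∩ S ⊆ P) (h : bisimType P M n '' X = bisimType P N n '' Y) :
    ∃ (K : KModel V) (Z : Set K.W), (∀ m, bisimType S K m '' Z = bisimType S M m '' X) ∧
      bisimType Q K n '' Z = bisimType Q N n '' Y := by
  rw [image_eq_image_iff] at h
  refine ⟨amalgam P Q M N, {z | ∃ v ∈ X, ∃ w ∈ Y, bisimType P M n v = bisimType P N n w ∧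
    z = (v, some (n, w))}, fun m => image_eq_image_iff.2 ⟨?_, fun v hv => ?_⟩,
    image_eq_image_iff.2 ⟨?_, fun w hw => ?_⟩⟩
  · rintro _ ⟨v, hv, w, -, he, rfl⟩
    exact ⟨v, hv, bisimType_amalgam_left hP m he⟩
  · obtain ⟨w, hw, he⟩ := h.1 v hv
    exact ⟨_, ⟨v, hv, w, hw, he, rfl⟩, bisimType_amalgam_left hP m he⟩
  · rintro _ ⟨v, -, w, hw, he, rfl⟩
    exact ⟨w, hw, bisimType_amalgam_right he⟩
  · obtain ⟨v, hv, he⟩ := h.2 w hw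
    exact ⟨_, ⟨v, hv, w, hw, he, rfl⟩, bisimType_amalgam_right he⟩

/-- Full Modal Team Logic enjoys uniform interpolation: for
every `FMTL` formula `φ` and `L' ⊆ L(φ)` there is an `FMTL` formula `θ`
with `L(θ) ⊆ L'`, `φ ⊨ θ`, and `θ ⊨ ψ` whenever `φ ⊨ ψ` and
`L(φ) ∩ L(ψ) ⊆ L'`. -/
theorem fmtl_uniform_interpolation {V : Type} (φ : MForm V) (L' : Set V)
    (hL' : L' ⊆ mletters φ) :
    ∃ θ : MForm V, mletters θ ⊆ L' ∧
      (∀ (M : KModel V) (X : Set M.W), MSat M X φ → MSat M X θ) ∧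
      (∀ ψ : MForm V,
        (∀ (M : KModel V) (X : Set M.W), MSat M X φ → MSat M X ψ) →
        mletters φ ∩ mletters ψ ⊆ L' →
        ∀ (M : KModel V) (X : Set M.W), MSat M X θ → MSat M X ψ) := by
  have : Finite L' := (finite_mletters φ).subset hL'
  obtain ⟨θ, hθ, hs⟩ := TeamDefinable.exists_mem (P := L')
    {T | ∃ (N : KModel V) (Y : Set N.W), MSat N Y φ ∧ bisimType L' N (modalDepth φ) '' Y = T}
    TeamDefinable.image_bisimType_eq
  refine ⟨θ, hθ, fun M X hX => (hs M X).2 ⟨_, ⟨M, X, hX, rfl⟩, rfl⟩, fun ψ hψ hl M X hX => ?_⟩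
  obtain ⟨_, ⟨N, Y, hY, rfl⟩, he⟩ := (hs M X).1 hX
  obtain ⟨K, Z, hM, hN⟩ := exists_team_amalgam hl he
  exact (hψ K Z (hY.of_image_eq subset_rfl le_rfl hN.symm)).of_image_eq subset_rfl le_rfl (hM _)
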